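/- Let V be a universal conditional decompressor, and let C_V(x) denote C_V(x | empty string). There exists a constant C₁ such that for all natural numbers n, k and every binary string y of length n with k = C_V(y | enc(n)) + 5, at least 99/100 of the k×n matrices A over ZMod 2 satisfy C_V(enc(A)·y) ≥ n·k + k − C₁. -/

import Mathlib

/-- Plain Kolmogorov complexity of `x` under decompressor `V`, in `ℕ∞` (`⊤` if no description). -/
noncomputable def plainC (V : List Bool →. List Bool) (x : List Bool) : ℕ∞ :=
  sInf {m : ℕ∞ | ∃ d : List Bool, x ∈ V d ∧ (d.length : ℕ∞) = m}

/-- Conditional Kolmogorov complexity of `x` given `y` under conditional decompressor `V`. -/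
noncomputable def condC (V : List Bool × List Bool →. List Bool) (x y : List Bool) : ℕ∞ :=
  sInf {m : ℕ∞ | ∃ d : List Bool, x ∈ V (d, y) ∧ (d.length : ℕ∞) = m}

/-- `V` is a universal plain decompressor. -/
def PlainUniversal (V : List Bool →. List Bool) : Prop :=
  Partrec V ∧ ∀ W : List Bool →. List Bool, Partrec W →
    ∃ c : ℕ, ∀ x : List Bool, plainC V x ≤ plainC W x + c

/-- `V` is a universal conditional decompressor. -/
def CondUniversal (V : List Bool × List Bool →. List Bool) : Prop :=
  Partrec V ∧ ∀ W : List Bool × List Bool →. List Bool, Partrec W →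
    ∃ c : ℕ, ∀ x y : List Bool, condC V x y ≤ condC W x y + c

/-- Row-major encoding of a `k × n` binary matrix as a binary string (length `n·k`). -/
def encM {k n : ℕ} (A : Matrix (Fin k) (Fin n) (ZMod 2)) : List Bool :=
  (List.finRange k).flatMap fun i => (List.finRange n).map fun j => decide (A i j = 1)

/-- The vector in `(ZMod 2)^n` associated to a binary string (of length `n`). -/
def vecOf (n : ℕ) (s : List Bool) : Fin n → ZMod 2 :=
  fun i => if s.getD i false then 1 else 0

/-- The binary string (of length `k`) associated to a vector in `(ZMod 2)^k`. -/
def strOf {k : ℕ} (v : Fin k → ZMod 2) : List Bool :=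
  List.ofFn fun i => decide (v i = 1)

/-- The partial recursive code associated to a binary string, via the canonical
computable bijection between `List Bool` and `Nat.Partrec.Code`. -/
def codeOf (x : List Bool) : Nat.Partrec.Code :=
  Denumerable.ofNat Nat.Partrec.Code (Encodable.encode x)

/-- The halting set: strings whose associated program halts on the empty input. -/
def Halts (x : List Bool) : Prop := ((codeOf x).eval 0).Dom


section Enumeration

variable {α β : Type*}

/-- The list, without repetitions, of the values among `f a 0, …, f a (t - 1)`, in order of first
appearance. -/
def enumNodup [DecidableEq β] (f : α → ℕ → Option β) (a : α) : ℕ → List β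
  | 0 => []
  | t + 1 => (f a t).elim (enumNodup f a t) fun b =>
      if b ∈ enumNodup f a t then enumNodup f a t else enumNodup f a t ++ [b]

theorem Primrec.enumNodup [DecidableEq β] [Primcodable α] [Primcodable β]
    {f : α → ℕ → Option β} (hf : Primrec₂ f) : Primrec₂ (enumNodup f) := by
  have hmem : PrimrecRel fun (b : β) (l : List β) => b ∈ l :=
    PrimrecRel.of_eq (r := fun (b : β) (l : List β) => l.idxOf b < l.length)
      (Primrec.nat_lt.comp (Primrec.list_idxOf.comp Primrec.fst Primrec.snd)
        (Primrec.list_length.comp Primrec.snd)) fun _ _ => List.idxOf_lt_length_iff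
  have hstep : Primrec₂ fun (a : α) (q : ℕ × List β) =>
      (f a q.1).elim q.2 fun b => if b ∈ q.2 then q.2 else q.2 ++ [b] := by
    have hl : Primrec fun x : (α × ℕ × List β) × β => x.1.2.2 :=
      Primrec.snd.comp (Primrec.snd.comp Primrec.fst)
    refine (Primrec.option_casesOn (o := fun x : α × ℕ × List β => f x.1 x.2.1)
      (f := fun x => x.2.2)
      (g := fun x b => if b ∈ x.2.2 then x.2.2 else x.2.2 ++ [b])
      (hf.comp Primrec.fst (Primrec.fst.comp Primrec.snd)) (Primrec.snd.comp Primrec.snd)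
      (Primrec.ite (hmem.comp Primrec.snd hl) hl
        (Primrec.list_concat.comp hl Primrec.snd))).of_eq fun x => ?_
    dsimp only
    cases f x.1 x.2.1 <;> rfl
  refine (Primrec.nat_rec (Primrec.const []) hstep).of_eq fun a t => ?_
  induction t with
  | zero => rfl
  | succ t ih => simp only [_root_.enumNodup, ← ih]

variable [DecidableEq β] {f : α → ℕ → Option β} {a : α}

theorem nodup_enumNodup (t : ℕ) : (enumNodup f a t).Nodup := by
  induction t with
  | zero => simp [enumNodup]
  | succ t ih =>
    rw [enumNodup]
    cases f a t with
    | none => simpa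
    | some b =>
      by_cases hb : b ∈ enumNodup f a t
      · simpa [hb]
      · simp only [Option.elim_some, hb, if_false]
        exact List.concat_eq_append ▸ (List.nodup_concat _ _).2 ⟨hb, ih⟩

theorem enumNodup_prefix_succ (t : ℕ) : enumNodup f a t <+: enumNodup f a (t + 1) := by
  rw [enumNodup]
  cases f a t with
  | none => simp
  | some b => by_cases hb : b ∈ enumNodup f a t <;> simp [hb]

theorem enumNodup_prefix {s t : ℕ} (h : s ≤ t) : enumNodup f a s <+: enumNodup f a t := by
  induction t, h using Nat.le_induction with
  | base => exact List.prefix_rfl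
  | succ t _ ih => exact ih.trans (enumNodup_prefix_succ t)

theorem mem_enumNodup {t : ℕ} {b : β} : b ∈ enumNodup f a t ↔ ∃ m < t, f a m = some b := by
  induction t with
  | zero => simp [enumNodup]
  | succ t ih =>
    rw [enumNodup]
    simp only [Nat.lt_succ_iff_lt_or_eq, or_and_right, exists_or, exists_eq_left, ← ih]
    cases f a t with
    | none => simp
    | some c =>
      by_cases hc : c ∈ enumNodup f a t
      · simp only [Option.elim_some, hc, if_true, Option.some.injEq]
        exact ⟨Or.inl, fun h => h.elim id fun h => h ▸ hc⟩
      · simp [hc, eq_comm]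

end Enumeration

section BinaryStrings

/-- The value of a binary string, least significant bit first. -/
def bitsVal (l : List Bool) : ℕ := l.foldr Nat.bit 0

theorem Primrec.bitsVal : Primrec bitsVal := by
  have hbit : Primrec₂ Nat.bit :=
    (Primrec.cond Primrec.fst
      (Primrec.nat_double_succ.comp Primrec.snd) (Primrec.nat_double.comp Primrec.snd)).of_eq
      fun x => by cases x.1 <;> simp [Nat.bit]
  exact Primrec.list_foldr Primrec.id (Primrec.const 0) (hbit.comp₂
    (Primrec.fst.comp₂ Primrec₂.right) (Primrec.snd.comp₂ Primrec₂.right))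

theorem bitsVal_bits (n : ℕ) : bitsVal n.bits = n := by
  induction n using Nat.binaryRec' with
  | zero => rfl
  | bit b n h ih => rw [Nat.bits_append_bit n b h, bitsVal, List.foldr_cons, ← bitsVal, ih]

theorem exists_bitsVal_eq {L i : ℕ} (h : i < 2 ^ L) :
    ∃ e : List Bool, e.length = L ∧ bitsVal e = i := by
  induction L generalizing i with
  | zero => exact ⟨[], rfl, by simpa [bitsVal, eq_comm] using h⟩
  | succ L ih =>
    obtain ⟨e, he, hv⟩ := ih (i := i.div2) (by rw [Nat.div2_val]; omega)
    exact ⟨i.bodd :: e, by simp [he], by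
      rw [bitsVal, List.foldr_cons, ← bitsVal, hv, Nat.bit_bodd_div2]⟩

/-- The binary strings of length less than `ℓ`. -/
def shortStrings : ℕ → Finset (List Bool)
  | 0 => ∅
  | ℓ + 1 => insert [] ((shortStrings ℓ).image (List.cons true) ∪
      (shortStrings ℓ).image (List.cons false))

theorem mem_shortStrings {ℓ : ℕ} {d : List Bool} : d ∈ shortStrings ℓ ↔ d.length < ℓ := by
  induction ℓ generalizing d with
  | zero => simp [shortStrings]
  | succ ℓ ih =>
    rcases d with _ | ⟨b, d⟩
    · simp [shortStrings]
    · cases b <;> simp [shortStrings, ih]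

theorem card_shortStrings_lt (ℓ : ℕ) : (shortStrings ℓ).card < 2 ^ ℓ := by
  induction ℓ with
  | zero => simp [shortStrings]
  | succ ℓ ih =>
    have h₁ := Finset.card_insert_le ([] : List Bool) ((shortStrings ℓ).image (List.cons true) ∪
      (shortStrings ℓ).image (List.cons false))
    have h₂ := Finset.card_union_le ((shortStrings ℓ).image (List.cons true))
      ((shortStrings ℓ).image (List.cons false))
    have h₃ := Finset.card_image_le (s := shortStrings ℓ) (f := List.cons true)
    have h₄ := Finset.card_image_le (s := shortStrings ℓ) (f := List.cons false)
    rw [shortStrings, pow_succ]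
    omega

/-- Fewer than `2 ^ ℓ` objects have descriptions of length less than `ℓ`. -/
theorem card_lt_of_short_descriptions {β : Type*} (g : List Bool →. β) {ℓ : ℕ} (s : Finset β)
    (h : ∀ z ∈ s, ∃ d : List Bool, d.length < ℓ ∧ z ∈ g d) : s.card < 2 ^ ℓ := by
  choose! d hd hg using h
  refine (Finset.card_le_card_of_injOn d (fun z hz => mem_shortStrings.2 (hd z hz)) ?_).trans_lt
    (card_shortStrings_lt ℓ)
  intro z hz w hw h
  have hz' := hg z hz
  rw [h] at hz'
  exact Part.mem_unique hz' (hg w hw)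

end BinaryStrings

section Matrices

variable {k n : ℕ}

theorem length_encM (A : Matrix (Fin k) (Fin n) (ZMod 2)) : (encM A).length = n * k := by
  simp [encM, List.length_flatMap, mul_comm]

theorem encM_injective :
    Function.Injective (encM : Matrix (Fin k) (Fin n) (ZMod 2) → List Bool) := by
  intro A B h
  have hrow : ∀ l : List (Fin k),
      (l.flatMap fun i => (List.finRange n).map fun j => decide (A i j = 1)) =
        (l.flatMap fun i => (List.finRange n).map fun j => decide (B i j = 1)) →
      ∀ i ∈ l, ∀ j, decide (A i j = 1) = decide (B i j = 1) := by
    intro l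
    induction l with
    | nil => simp
    | cons i l ih =>
      intro h
      rw [List.flatMap_cons, List.flatMap_cons] at h
      obtain ⟨h₁, h₂⟩ := List.append_inj h (by simp)
      intro i' hi' j
      rcases List.mem_cons.1 hi' with rfl | hi'
      · exact List.map_inj_left.1 h₁ j (List.mem_finRange j)
      · exact ih h₂ i' hi' j
  ext i j
  have hij := hrow _ h i (List.mem_finRange i) j
  have key : ∀ u v : ZMod 2, decide (u = 1) = decide (v = 1) → u = v := by decide
  rw [key _ _ hij]

end Matrices

section Complexity

theorem condC_le_length {V : List Bool × List Bool →. List Bool} {d x y : List Bool}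
    (h : x ∈ V (d, y)) : condC V x y ≤ d.length :=
  sInf_le ⟨d, h, rfl⟩

theorem exists_description_of_condC_lt {V : List Bool × List Bool →. List Bool}
    {x y : List Bool} {m : ℕ} (h : condC V x y < m) :
    ∃ d : List Bool, d.length < m ∧ x ∈ V (d, y) := by
  obtain ⟨_, ⟨d, hd, rfl⟩, hm⟩ := sInf_lt_iff.1 h
  exact ⟨d, by exact_mod_cast hm, hd⟩

end Complexity

section HeavySuffixes

open Nat.Partrec (Code)

/-- The output, if any, of the candidate computation number `m`: `m` codes a number of steps and a
program, which has to be shorter than `ℓ`. -/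
def shortOutput (c : Code) (ℓ m : ℕ) : Option (List Bool) :=
  (Encodable.decode (α := List Bool) m.unpair.2).bind fun d =>
    if d.length < ℓ then
      (c.evaln m.unpair.1 (Encodable.encode (d, ([] : List Bool)))).bind Encodable.decode
    else none

/-- The number of strings found within `t` steps that have short descriptions and become `y` when
their first `K` letters are removed. -/
def suffixCount (c : Code) (K ℓ t : ℕ) (y : List Bool) : ℕ :=
  ((enumNodup (shortOutput c) ℓ t).filter fun z => z.drop K = y).length

/-- The string `y` coded by `m`, if it is found to be a suffix of many strings with short
descriptions within the number of steps coded by `m`. -/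
def heavySuffix (c : Code) (p : ℕ × ℕ) (m : ℕ) : Option (List Bool) :=
  (Encodable.decode (α := List Bool) m.unpair.2).bind fun y =>
    if 2 ^ p.1 < 100 * suffixCount c p.1 p.2 m.unpair.1 y then some y else none

theorem primrec_shortOutput (c : Code) : Primrec₂ (shortOutput c) := by
  have hm : Primrec fun x : (ℕ × ℕ) × List Bool => x.1.2.unpair.1 :=
    Primrec.fst.comp (Primrec.unpair.comp (Primrec.snd.comp Primrec.fst))
  have hev : Primrec fun x : (ℕ × ℕ) × List Bool =>
      c.evaln x.1.2.unpair.1 (Encodable.encode (x.2, ([] : List Bool))) :=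
    Code.primrec_evaln.comp (((hm.pair (Primrec.const c))).pair
      (Primrec.encode.comp (Primrec.snd.pair (Primrec.const []))))
  exact Primrec.option_bind
    (Primrec.decode.comp (Primrec.snd.comp (Primrec.unpair.comp Primrec.snd)))
    (Primrec.ite (Primrec.nat_lt.comp (Primrec.list_length.comp Primrec.snd)
        (Primrec.fst.comp Primrec.fst))
      (Primrec.option_bind hev (Primrec.decode.comp Primrec.snd).to₂)
      (Primrec.const none))

theorem primrec_heavySuffix (c : Code) : Primrec₂ (heavySuffix c) := by
  have hR : PrimrecRel fun (z : List Bool) (q : ℕ × List Bool) => z.drop q.1 = q.2 :=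
    Primrec.eq.comp (Primrec.list_drop.comp (Primrec.fst.comp Primrec.snd) Primrec.fst)
      (Primrec.snd.comp Primrec.snd)
  have hpow : Primrec₂ ((· ^ ·) : ℕ → ℕ → ℕ) := Primrec₂.unpaired'.1 Nat.Primrec.pow
  have hp : Primrec fun x : ((ℕ × ℕ) × ℕ) × List Bool => x.1.1 :=
    Primrec.fst.comp Primrec.fst
  have hK := Primrec.fst.comp hp
  have ht : Primrec fun x : ((ℕ × ℕ) × ℕ) × List Bool => x.1.2.unpair.1 :=
    Primrec.fst.comp (Primrec.unpair.comp (Primrec.snd.comp Primrec.fst))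
  have hcount : Primrec fun x : ((ℕ × ℕ) × ℕ) × List Bool =>
      suffixCount c x.1.1.1 x.1.1.2 x.1.2.unpair.1 x.2 :=
    Primrec.list_length.comp (hR.listFilter.comp
      ((Primrec.enumNodup (primrec_shortOutput c)).comp (Primrec.snd.comp hp) ht)
      (hK.pair Primrec.snd))
  exact Primrec.option_bind
    (Primrec.decode.comp (Primrec.snd.comp (Primrec.unpair.comp Primrec.snd)))
    (Primrec.ite (Primrec.nat_lt.comp (hpow.comp (Primrec.const 2) hK)
        (Primrec.nat_mul.comp (Primrec.const 100) hcount))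
      (Primrec.option_some.comp Primrec.snd) (Primrec.const none))

/-- `c` computes `V` up to encoding. -/
def Computes (c : Code) (V : List Bool × List Bool →. List Bool) : Prop :=
  ∀ d, c.eval (Encodable.encode d) = (V d).map Encodable.encode

theorem exists_computes {V : List Bool × List Bool →. List Bool} (hV : Partrec V) :
    ∃ c, Computes c V := by
  obtain ⟨c, hc⟩ := Code.exists_code.1 hV
  exact ⟨c, fun d => by simp [hc]⟩

variable {c : Code} {V : List Bool × List Bool →. List Bool}

theorem Computes.of_shortOutput (hc : Computes c V) {ℓ m : ℕ} {z : List Bool}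
    (h : shortOutput c ℓ m = some z) : ∃ d : List Bool, d.length < ℓ ∧ z ∈ V (d, []) := by
  obtain ⟨d, -, h⟩ := Option.bind_eq_some_iff.1 h
  split_ifs at h with hd
  obtain ⟨u, hu, hz⟩ := Option.bind_eq_some_iff.1 h
  have := Code.evaln_sound hu
  rw [hc] at this
  obtain ⟨w, hw, rfl⟩ := (Part.mem_map_iff _).1 this
  rw [Encodable.encodek, Option.some_inj] at hz
  exact ⟨d, hd, hz ▸ hw⟩

theorem Computes.exists_shortOutput (hc : Computes c V) {ℓ : ℕ} {d z : List Bool}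
    (hd : d.length < ℓ) (hz : z ∈ V (d, [])) : ∃ m, shortOutput c ℓ m = some z := by
  have : Encodable.encode z ∈ c.eval (Encodable.encode (d, ([] : List Bool))) := by
    rw [hc]
    exact Part.mem_map _ hz
  obtain ⟨s, hs⟩ := Code.evaln_complete.1 this
  refine ⟨Nat.pair s (Encodable.encode d), ?_⟩
  simp only [shortOutput, Nat.unpair_pair, Encodable.encodek, Option.bind_some, hd, if_true]
  rw [Option.mem_def.1 hs, Option.bind_some, Encodable.encodek]

theorem suffixCount_mono (K ℓ : ℕ) (y : List Bool) {s t : ℕ} (h : s ≤ t) :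
    suffixCount c K ℓ s y ≤ suffixCount c K ℓ t y :=
  ((enumNodup_prefix h).sublist.filter _).length_le

theorem lt_suffixCount_of_mem {p : ℕ × ℕ} {t : ℕ} {y : List Bool}
    (h : y ∈ enumNodup (heavySuffix c) p t) :
    2 ^ p.1 < 100 * suffixCount c p.1 p.2 t y := by
  obtain ⟨m, hm, h⟩ := mem_enumNodup.1 h
  obtain ⟨w, -, h⟩ := Option.bind_eq_some_iff.1 h
  split_ifs at h with hw
  obtain rfl := Option.some_inj.1 h
  exact hw.trans_le (Nat.mul_le_mul_left _
    (suffixCount_mono _ _ _ ((Nat.unpair_left_le m).trans hm.le)))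

theorem exists_mem_enumNodup_heavySuffix {p : ℕ × ℕ} {t : ℕ} {y : List Bool}
    (h : 2 ^ p.1 < 100 * suffixCount c p.1 p.2 t y) :
    ∃ s, y ∈ enumNodup (heavySuffix c) p s := by
  refine ⟨Nat.pair t (Encodable.encode y) + 1, mem_enumNodup.2 ⟨_, Nat.lt_succ_self _, ?_⟩⟩
  simp [heavySuffix, h]

theorem suffixCount_eq_card (K ℓ t : ℕ) (y : List Bool) : suffixCount c K ℓ t y =
    ((enumNodup (shortOutput c) ℓ t).toFinset.filter fun z => z.drop K = y).card := by
  rw [suffixCount, ← List.toFinset_card_of_nodup ((nodup_enumNodup t).filter _),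
    List.toFinset_filter]
  simp

/-- There are few heavy suffixes. -/
theorem Computes.length_heavySuffix_mul_le (hc : Computes c V) (p : ℕ × ℕ) (t : ℕ) :
    (enumNodup (heavySuffix c) p t).length * 2 ^ p.1 ≤ 100 * (2 ^ p.2 - 1) := by
  set Z := (enumNodup (shortOutput c) p.2 t).toFinset
  have hZ : Z.card < 2 ^ p.2 := by
    refine card_lt_of_short_descriptions (fun d => V (d, [])) Z fun z hz => ?_
    obtain ⟨m, -, hm⟩ := mem_enumNodup.1 (List.mem_toFinset.1 hz)
    exact hc.of_shortOutput hm
  rw [← List.toFinset_card_of_nodup (nodup_enumNodup t)]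
  set Y := (enumNodup (heavySuffix c) p t).toFinset
  calc Y.card * 2 ^ p.1 ≤ ∑ y ∈ Y, 100 * (Z.filter fun z => z.drop p.1 = y).card := by
        rw [← smul_eq_mul]
        refine Finset.card_nsmul_le_sum _ _ _ fun y hy => ?_
        rw [← suffixCount_eq_card]
        exact (lt_suffixCount_of_mem (List.mem_toFinset.1 hy)).le
    _ = 100 * (Z.filter fun z => z.drop p.1 ∈ Y).card := by
        rw [← Finset.mul_sum, Finset.sum_card_fiberwise_eq_card_filter]
    _ ≤ 100 * (2 ^ p.2 - 1) := by
        have := Finset.card_filter_le Z fun z => z.drop p.1 ∈ Y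
        omega

/-- Finitely many strings with short descriptions are all found at some stage. -/
theorem Computes.exists_subset_enumNodup (hc : Computes c V) {ℓ : ℕ} (s : Finset (List Bool))
    (h : ∀ z ∈ s, ∃ d : List Bool, d.length < ℓ ∧ z ∈ V (d, [])) :
    ∃ t, s ⊆ (enumNodup (shortOutput c) ℓ t).toFinset := by
  have h' : ∀ z ∈ s, ∃ m, shortOutput c ℓ m = some z := fun z hz =>
    let ⟨_, hd, hz⟩ := h z hz
    hc.exists_shortOutput hd hz
  choose! m hm using h'
  exact ⟨s.sup m + 1, fun z hz => List.mem_toFinset.2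
    (mem_enumNodup.2 ⟨m z, Nat.lt_succ_of_le (Finset.le_sup hz), hm z hz⟩)⟩

/-- The conditional decompressor which, given `n` in binary, reads a program made of `j` ones, a
zero and a string `e`: the value of `e` is the position of the output in the list of heavy
suffixes, for the parameters determined by `n`, `j` and the length of `e`. -/
def suffixDecompressor (c : Code) : List Bool × List Bool →. List Bool := fun x =>
  let j := x.1.findIdx (!·)
  let e := x.1.drop (j + 1)
  let k := e.length + 2 * j
  let K := bitsVal x.2 * k
  Nat.rfindOpt fun t => (enumNodup (heavySuffix c) (K, K + k - (2 * j + 7)) t)[bitsVal e]?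

theorem partrec_suffixDecompressor (c : Code) : Partrec (suffixDecompressor c) := by
  have hj : Primrec fun x : List Bool × List Bool => x.1.findIdx (!·) :=
    Primrec.list_findIdx Primrec.fst (Primrec.not.comp Primrec.snd)
  have he := Primrec.list_drop.comp (Primrec.succ.comp hj) Primrec.fst
  have hj2 := Primrec.nat_mul.comp (Primrec.const 2) hj
  have hk := Primrec.nat_add.comp (Primrec.list_length.comp he) hj2
  have hK := Primrec.nat_mul.comp (Primrec.bitsVal.comp Primrec.snd) hk
  have hl := Primrec.nat_sub.comp (Primrec.nat_add.comp hK hk)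
    (Primrec.nat_add.comp hj2 (Primrec.const 7))
  exact Partrec.rfindOpt (Primrec.to_comp (Primrec.list_getElem?.comp
    ((Primrec.enumNodup (primrec_heavySuffix c)).comp ((hK.pair hl).comp Primrec.fst) Primrec.snd)
    (Primrec.bitsVal.comp (he.comp Primrec.fst))))

theorem mem_suffixDecompressor {j n i t : ℕ} {e y : List Bool} (he : bitsVal e = i)
    (h : (enumNodup (heavySuffix c) (n * (e.length + 2 * j),
      n * (e.length + 2 * j) + (e.length + 2 * j) - (2 * j + 7)) t)[i]? = some y) :
    y ∈ suffixDecompressor c (List.replicate j true ++ false :: e, n.bits) := by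
  have hj : (List.replicate j true ++ false :: e).findIdx (!·) = j := by
    clear h
    induction j with
    | zero => simp [List.findIdx_cons]
    | succ j ih => simpa [List.replicate_succ, List.findIdx_cons] using ih
  have hd : (List.replicate j true ++ false :: e).drop (j + 1) = e := by
    simp [List.drop_append]
  simp only [suffixDecompressor, hj, hd, bitsVal_bits, he]
  refine (Nat.rfindOpt_mono fun hst ha => ?_).2 ⟨t, h⟩
  obtain ⟨l, hl⟩ := enumNodup_prefix (f := heavySuffix c) hst
  rw [Option.mem_def] at ha ⊢
  rw [← hl]
  exact List.getElem?_append_left (List.getElem?_eq_some_iff.1 ha).1 ▸ ha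

/-- A string that is a suffix of many strings with short descriptions is itself compressible. -/
theorem Computes.condC_suffixDecompressor_le (hc : Computes c V) {n L j t : ℕ} {y : List Bool}
    (h : y ∈ enumNodup (heavySuffix c) (n * (L + 2 * j),
      n * (L + 2 * j) + (L + 2 * j) - (2 * j + 7)) t) :
    condC (suffixDecompressor c) y n.bits ≤ (L + j + 1 : ℕ) := by
  set K := n * (L + 2 * j)
  set l := enumNodup (heavySuffix c) (K, K + (L + 2 * j) - (2 * j + 7)) t with hl
  obtain ⟨i, hi, rfl⟩ := List.getElem_of_mem h
  have hlen : l.length ≤ 2 ^ L := by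
    have h₁ := hc.length_heavySuffix_mul_le (K, K + (L + 2 * j) - (2 * j + 7)) t
    rw [← hl] at h₁
    refine Nat.le_of_mul_le_mul_right (h₁.trans ?_) (Nat.two_pow_pos K)
    rw [← pow_add, show K + (L + 2 * j) - (2 * j + 7) = L + K - 7 by omega]
    rcases Nat.lt_or_ge (L + K) 7 with h7 | h7
    · simp [Nat.sub_eq_zero_of_le h7.le]
    · obtain ⟨r, hr⟩ := Nat.exists_eq_add_of_le' h7
      rw [hr, Nat.add_sub_cancel, pow_add]
      dsimp only
      omega
  obtain ⟨e, rfl, he⟩ := exists_bitsVal_eq (hi.trans_le hlen)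
  refine (condC_le_length (mem_suffixDecompressor (j := j) (n := n) (t := t) he
    (List.getElem?_eq_getElem hi))).trans ?_
  simp only [List.length_append, List.length_replicate, List.length_cons]
  exact_mod_cast (by omega)

end HeavySuffixes

/-- Second claim in Lemma 3: there is a constant `C₁` such that for every string `y`
of length `n` and `k = C_V(y | n) + 5`, at least `99/100` of the `k × n` binary
matrices `A` satisfy `C_V(enc(A)·y) ≥ n·k + k - C₁`. -/
theorem most_matrices_Ay_incompressible (V : List Bool × List Bool →. List Bool)
    (hV : CondUniversal V) :
    ∃ C₁ : ℕ, ∀ (n k : ℕ) (y : List Bool), y.length = n →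
      (k : ℕ∞) = condC V y (Nat.bits n) + 5 →
      99 * 2 ^ (n * k) ≤ 100 * Nat.card {A : Matrix (Fin k) (Fin n) (ZMod 2) //
        ((n * k + k - C₁ : ℕ) : ℕ∞) ≤ condC V (encM A ++ y) []} := by
  classical
  obtain ⟨c, hc⟩ := exists_computes hV.1
  obtain ⟨b, hb⟩ := hV.2 _ (partrec_suffixDecompressor c)
  set j := b + 7 with hj
  refine ⟨2 * j + 7, fun n k y _ hk => ?_⟩
  set ℓ := n * k + k - (2 * j + 7) with hℓ
  set bad : Finset (Matrix (Fin k) (Fin n) (ZMod 2)) :=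
    Finset.univ.filter fun A => ¬ (ℓ : ℕ∞) ≤ condC V (encM A ++ y) [] with hbad
  suffices h : 100 * bad.card ≤ 2 ^ (n * k) by
    rw [Nat.card_eq_fintype_card, Fintype.card_subtype]
    have h₁ : (Finset.univ.filter fun A : Matrix (Fin k) (Fin n) (ZMod 2) =>
        (ℓ : ℕ∞) ≤ condC V (encM A ++ y) []).card + bad.card =
          (Finset.univ : Finset (Matrix (Fin k) (Fin n) (ZMod 2))).card := by
      rw [hbad, Finset.card_filter_add_card_filter_not]
    have h₂ : (Finset.univ : Finset (Matrix (Fin k) (Fin n) (ZMod 2))).card = 2 ^ (n * k) := by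
      exact (Fintype.card_congr (Matrix.of (α := ZMod 2)).symm).trans
        (by simp [← pow_mul])
    rw [h₂] at h₁
    omega
  by_contra! hlt
  have hinj : Function.Injective
      fun A : Matrix (Fin k) (Fin n) (ZMod 2) => encM A ++ y :=
    (List.append_left_injective y).comp encM_injective
  set S := bad.image fun A => encM A ++ y
  have hScard : S.card = bad.card := Finset.card_image_of_injective _ hinj
  have hshort : ∀ z ∈ S, ∃ d : List Bool, d.length < ℓ ∧ z ∈ V (d, []) := by
    intro z hz
    obtain ⟨A, hA, rfl⟩ := Finset.mem_image.1 hz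
    exact exists_description_of_condC_lt (not_le.1 (Finset.mem_filter.1 hA).2)
  rcases Nat.lt_or_ge k (2 * j) with hkj | hkj
  · have h₁ := card_lt_of_short_descriptions (fun d => V (d, [])) S hshort
    rcases Nat.lt_or_ge (n * k) 7 with h7 | h7
    · have h₀ : ℓ = 0 := by omega
      rw [h₀] at h₁
      have := Nat.two_pow_pos (n * k)
      omega
    · have h₂ : 2 ^ ℓ ≤ 2 ^ (n * k - 7) := Nat.pow_le_pow_right two_pos (by omega)
      have h₃ : 2 ^ (n * k) = 2 ^ (n * k - 7) * 2 ^ 7 := by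
        rw [← pow_add, Nat.sub_add_cancel h7]
      omega
  · obtain ⟨L, rfl⟩ := Nat.exists_eq_add_of_le' hkj
    obtain ⟨t, ht⟩ := hc.exists_subset_enumNodup S hshort
    have hcount : bad.card ≤ suffixCount c (n * (L + 2 * j)) ℓ t y := by
      rw [suffixCount_eq_card, ← hScard]
      refine Finset.card_le_card fun z hz => Finset.mem_filter.2 ⟨ht hz, ?_⟩
      obtain ⟨A, -, rfl⟩ := Finset.mem_image.1 hz
      simp [length_encM]
    obtain ⟨s, hs⟩ := exists_mem_enumNodup_heavySuffix (p := (n * (L + 2 * j), ℓ))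
      (hlt.trans_le (Nat.mul_le_mul_left 100 hcount))
    have hle : ((L + 2 * j : ℕ) : ℕ∞) ≤ ((L + j + 1 : ℕ) : ℕ∞) + b + 5 := by
      rw [hk]
      gcongr
      exact (hb y n.bits).trans (by gcongr; exact hc.condC_suffixDecompressor_le hs)
    have : L + 2 * j ≤ L + j + 1 + b + 5 := by exact_mod_cast hle
    omega
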